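/- arXiv:2512.04929 — 6 statements merged into one kernel-verified Lean document; each statement's English description precedes it below -/
import Mathlib

section
/- Let H₁ be a real Hilbert space, X a nonempty set, φ : X → H₁ a map, and let A be the linear map sending v ∈ H₁ to the function (Av)(x) := ⟨v, φ_x⟩_{H₁} on X. For g in the range R(A) let v_g denote the unique element of N(A)^⊥ with A v_g = g, and equip R(A) with the inner product ⟨g,h⟩ := ⟨v_g, v_h⟩_{H₁}. Then: (i) R(A) with this inner product is complete, hence a Hilbert space; (ii) for every x ∈ X the evaluation functional u ↦ u(x) on R(A) is bounded with norm at most ‖φ_x‖_{H₁}; (iii) setting K(x,x') := ⟨φ_x, φ_{x'}⟩_{H₁}, one has K(·,x) = A φ_x ∈ R(A) and ⟨K(·,x), u⟩ = u(x) for every u ∈ R(A) and x ∈ X. In other words, R(A) is a reproducing kernel Hilbert space with reproducing kernel K. -/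
open scoped RealInnerProductSpace

/-- A section of `A` with values in `(ker A)ᗮ` is a left inverse of `A` on `(ker A)ᗮ`. -/
lemma section_apply_eq_self_of_mem_ker_orthogonal {E F : Type*} [NormedAddCommGroup E]
    [InnerProductSpace ℝ E] [AddCommGroup F] [Module ℝ F] (A : E →ₗ[ℝ] F) (s : F → E)
    (hs : ∀ g ∈ Set.range A, s g ∈ (LinearMap.ker A)ᗮ ∧ A (s g) = g)
    {v : E} (hv : v ∈ (LinearMap.ker A)ᗮ) : s (A v) = v := by
  obtain ⟨hmem, heq⟩ := hs (A v) ⟨v, rfl⟩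
  exact LinearMap.injOn_of_disjoint_ker le_rfl (Submodule.orthogonal_disjoint (LinearMap.ker A)).symm
    hmem hv heq

/-- The range of the operator `A v = fun x => ⟪v, φ x⟫` is a reproducing kernel Hilbert
space: with the inner product `⟪g, h⟫ := ⟪v_g, v_h⟫` (where `v_g` is the unique element of
`(ker A)ᗮ` with `A v_g = g`) it is complete, all evaluation functionals are bounded (with
norm at most `‖φ x‖`), and `K(x, x') := ⟪φ x, φ x'⟫` is its reproducing kernel. -/
theorem stmt0
    {H₁ : Type*} [NormedAddCommGroup H₁] [InnerProductSpace ℝ H₁] [CompleteSpace H₁]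
    {X : Type*} [Nonempty X] (φ : X → H₁)
    (A : H₁ →ₗ[ℝ] (X → ℝ))
    (hA : ∀ (v : H₁) (x : X), A v x = ⟪v, φ x⟫)
    (vrep : (X → ℝ) → H₁)
    (hvrep : ∀ g ∈ Set.range A, vrep g ∈ (LinearMap.ker A)ᗮ ∧ A (vrep g) = g) :
    -- (i) completeness of `R(A)` with the inner product `⟪g, h⟫ := ⟪vrep g, vrep h⟫`
    (∀ u : ℕ → (X → ℝ), (∀ k, u k ∈ Set.range A) →
      CauchySeq (fun k => vrep (u k)) →
      ∃ g ∈ Set.range A,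
        Filter.Tendsto (fun k => vrep (u k)) Filter.atTop (nhds (vrep g))) ∧
    -- (ii) the evaluation functionals are bounded with norm at most `‖φ x‖`
    (∀ (x : X), ∀ g ∈ Set.range A, |g x| ≤ ‖φ x‖ * ‖vrep g‖) ∧
    -- (iii) `K(·, x) = A (φ x)` belongs to `R(A)` and reproduces point evaluations
    (∀ x : X, (fun x' => ⟪φ x', φ x⟫) = A (φ x) ∧
      (fun x' => ⟪φ x', φ x⟫) ∈ Set.range A ∧
      ∀ g ∈ Set.range A, ⟪vrep (fun x' => ⟪φ x', φ x⟫), vrep g⟫ = g x) := by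
  have hφ : ∀ x, φ x ∈ (LinearMap.ker A)ᗮ := fun x v hv => by
    rw [← hA, LinearMap.mem_ker.1 hv, Pi.zero_apply]
  have hK : ∀ x, (fun x' => ⟪φ x', φ x⟫) = A (φ x) := fun x => by
    ext x'
    rw [hA, real_inner_comm]
  have heval : ∀ x, ∀ g ∈ Set.range A, ⟪φ x, vrep g⟫ = g x := fun x g hg => by
    rw [real_inner_comm, ← hA, (hvrep g hg).2]
  refine ⟨fun u hu hc => ?_, fun x g hg => ?_, fun x => ⟨hK x, ⟨φ x, (hK x).symm⟩, ?_⟩⟩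
  · obtain ⟨v, hv⟩ := cauchySeq_tendsto_of_complete hc
    have hmem : v ∈ (LinearMap.ker A)ᗮ :=
      (Submodule.isClosed_orthogonal _).mem_of_tendsto hv
        (Filter.Eventually.of_forall fun k => (hvrep (u k) (hu k)).1)
    refine ⟨A v, ⟨v, rfl⟩, ?_⟩
    rwa [section_apply_eq_self_of_mem_ker_orthogonal A vrep hvrep hmem]
  · rw [← heval x g hg]
    exact abs_real_inner_le_norm _ _
  · intro g hg
    rw [hK, section_apply_eq_self_of_mem_ker_orthogonal A vrep hvrep (hφ x), heval x g hg]
end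

section
/- Let H₁ be a real Hilbert space, X a nonempty set, φ : X → H₁ a map, and let F be the closed linear span of {φ_x : x ∈ X} in H₁. Let v, v̂ ∈ F and define g(x) := ⟨φ_x, v⟩_{H₁} and ĝ(x) := ⟨φ_x, v̂⟩_{H₁}, and assume g − ĝ is bounded on X. Let ψ = ψ₁ + ψ₂ where ψ₂ is orthogonal to F and ψ₁ is the H₁-limit of partial sums Σ_{i=1}^n c_i φ_{x_i} for points (x_i) ⊂ X and coefficients with Σ_{i=1}^∞ |c_i| ≤ C < ∞. Then |⟨ψ, v − v̂⟩_{H₁}| ≤ C · sup_{x∈X} |g(x) − ĝ(x)|. -/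
open scoped RealInnerProductSpace

/-- Weak error bound: for `v, v̂` in the closed span `F` of the features, data functions
`g x = ⟪φ x, v⟫`, `ĝ x = ⟪φ x, v̂⟫` with `g − ĝ` bounded, and a test function
`ψ = ψ₁ + ψ₂` with `ψ₂ ⊥ F` and `ψ₁` an absolutely convergent combination of features
with coefficient `ℓ¹`-norm at most `C`, one has `|⟪ψ, v − v̂⟫| ≤ C * sup_x |g x − ĝ x|`. -/
theorem stmt4
    {H₁ : Type*} [NormedAddCommGroup H₁] [InnerProductSpace ℝ H₁] [CompleteSpace H₁]
    {X : Type*} [Nonempty X] (φ : X → H₁)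
    (v vhat ψ ψ₁ ψ₂ : H₁)
    (hv : v ∈ (Submodule.span ℝ (Set.range φ)).topologicalClosure)
    (hvhat : vhat ∈ (Submodule.span ℝ (Set.range φ)).topologicalClosure)
    (hbdd : BddAbove (Set.range fun x => |⟪φ x, v⟫ - ⟪φ x, vhat⟫|))
    (hψ : ψ = ψ₁ + ψ₂)
    (hψ₂ : ψ₂ ∈ ((Submodule.span ℝ (Set.range φ)).topologicalClosure)ᗮ)
    (x : ℕ → X) (c : ℕ → ℝ) (C : ℝ)
    (hsum : Summable fun i => |c i|)
    (hC : ∑' i, |c i| ≤ C)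
    (hψ₁ : Filter.Tendsto (fun n => ∑ i ∈ Finset.range n, c i • φ (x i))
      Filter.atTop (nhds ψ₁)) :
    |⟪ψ, v - vhat⟫| ≤ C * ⨆ x : X, |⟪φ x, v⟫ - ⟪φ x, vhat⟫| := by
  have h_perp : ⟪ψ₂, v - vhat⟫ = 0 :=
    Submodule.inner_left_of_mem_orthogonal (Submodule.sub_mem _ hv hvhat) hψ₂
  rw [hψ, inner_add_left, h_perp, add_zero]
  set S := ⨆ x : X, |⟪φ x, v⟫ - ⟪φ x, vhat⟫|
  have h_le (y : X) : |⟪φ y, v - vhat⟫| ≤ S := by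
    rw [inner_sub_right]
    exact le_ciSup hbdd y
  have hS : 0 ≤ S := Real.iSup_nonneg fun _ => abs_nonneg _
  refine le_of_tendsto (hψ₁.inner tendsto_const_nhds).abs (Filter.Eventually.of_forall fun n => ?_)
  calc |⟪∑ i ∈ Finset.range n, c i • φ (x i), v - vhat⟫|
      = |∑ i ∈ Finset.range n, c i * ⟪φ (x i), v - vhat⟫| := by
        simp only [sum_inner, real_inner_smul_left]
    _ ≤ ∑ i ∈ Finset.range n, |c i * ⟪φ (x i), v - vhat⟫| := Finset.abs_sum_le_sum_abs _ _
    _ ≤ ∑ i ∈ Finset.range n, |c i| * S := by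
        gcongr with i
        rw [abs_mul]
        gcongr
        exact h_le (x i)
    _ = (∑ i ∈ Finset.range n, |c i|) * S := (Finset.sum_mul _ _ _).symm
    _ ≤ C * S := by
        gcongr
        exact (hsum.sum_le_tsum _ fun _ _ => abs_nonneg _).trans hC
end

section
/- Let H_K be a reproducing kernel Hilbert space on X with kernel K, let X_n = {x₁,…,x_n} ⊂ X be pairwise distinct points with Gram matrix 𝖪 := (K(x_i,x_j))_{i,j=1}^n, and for λ > 0 let s_λ : [0,∞) → ℝ satisfy sup_{t∈[0,‖𝖪‖]} |t^{1/2}(1 − t·s_λ(t))| ≤ C_{1/2}·λ^{1/2} for all λ > 0 (qualification at least 1/2). For g ∈ H_K define ĝ_λ := Σ_{i=1}^n α_i K(·,x_i) with α := s_λ(𝖪)·(g(x₁),…,g(x_n))ᵀ, where s_λ(𝖪) is obtained by applying s_λ to the eigenvalues in an orthonormal eigendecomposition of 𝖪. Then for every g ∈ H_K and λ > 0: ( Σ_{j=1}^n (g(x_j) − ĝ_λ(x_j))² )^{1/2} ≤ C_{1/2} · λ^{1/2} · ‖g‖_{H_K}. -/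
open scoped RealInnerProductSpace

/-- The Gram matrix of the kernel `K` at the nodes `x`. -/
def gramMatrix {X : Type*} (K : X → X → ℝ) {n : ℕ} (x : Fin n → X) :
    Matrix (Fin n) (Fin n) ℝ :=
  Matrix.of fun i j => K (x i) (x j)

/-- The spectral calculus `s(𝖪) := U s(Σ) Uᵀ` associated with an orthonormal
eigendecomposition `𝖪 = U Σ Uᵀ`. -/
def spectralCalc {n : ℕ} (s : ℝ → ℝ) (U : Matrix (Fin n) (Fin n) ℝ)
    (σd : Fin n → ℝ) : Matrix (Fin n) (Fin n) ℝ :=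
  U * Matrix.diagonal (fun j => s (σd j)) * U.transpose

/-- Bessel's inequality for an orthogonal (not necessarily normalized) finite family. -/
theorem sum_inner_sq_div_norm_sq_le {H ι : Type*} [NormedAddCommGroup H]
    [InnerProductSpace ℝ H] [Fintype ι] {v : ι → H}
    (hv : Pairwise fun i j => ⟪v i, v j⟫ = 0) (g : H) :
    ∑ i, ⟪g, v i⟫ ^ 2 / ‖v i‖ ^ 2 ≤ ‖g‖ ^ 2 := by
  set S := ∑ i, ⟪g, v i⟫ ^ 2 / ‖v i‖ ^ 2
  set h : H := ∑ i, (⟪g, v i⟫ / ‖v i‖ ^ 2) • v i with h_def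
  have hgh : ⟪g, h⟫ = S := by
    simp only [h_def, inner_sum, inner_smul_right, S]
    exact Finset.sum_congr rfl fun i _ => by ring
  have hvh (i : ι) : ⟪v i, h⟫ = ⟪g, v i⟫ := by
    rw [h_def, inner_sum, Finset.sum_eq_single i]
    · rcases eq_or_ne (v i) 0 with h0 | h0
      · simp [h0]
      · rw [inner_smul_right, real_inner_self_eq_norm_sq]
        field_simp
    · intro j _ hj
      rw [inner_smul_right, hv hj.symm, mul_zero]
    · simp
  have hhh : ⟪h, h⟫ = S := by
    conv_lhs => rw [h_def, sum_inner]
    simp only [real_inner_smul_left, ← h_def, hvh, S]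
    exact Finset.sum_congr rfl fun i _ => by ring
  have hsq : 0 ≤ ‖g - h‖ ^ 2 := sq_nonneg _
  rw [norm_sub_sq_real, hgh, ← real_inner_self_eq_norm_sq h, hhh] at hsq
  linarith

/-- A column of an orthogonal matrix `U` is an eigenvector of `U Σ Uᵀ`, so the corresponding
diagonal entry is at most the operator norm. -/
theorem abs_le_norm_toEuclideanCLM_of_eq_mul_diagonal_mul_transpose {n : ℕ}
    {A U : Matrix (Fin n) (Fin n) ℝ} {σd : Fin n → ℝ} (hU : U.transpose * U = 1)
    (hA : A = U * Matrix.diagonal σd * U.transpose) (j : Fin n) :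
    |σd j| ≤ ‖Matrix.toEuclideanCLM (𝕜 := ℝ) A‖ := by
  set u : EuclideanSpace ℝ (Fin n) := WithLp.toLp 2 (U.mulVec (Pi.single j 1)) with hu
  have hAu : Matrix.toEuclideanCLM (𝕜 := ℝ) A u = σd j • u := by
    have hAU : A * U = U * Matrix.diagonal σd := by
      rw [hA, Matrix.mul_assoc, hU, Matrix.mul_one]
    rw [hu, Matrix.toEuclideanCLM_toLp, Matrix.mulVec_mulVec, hAU, ← Matrix.mulVec_mulVec,
      Matrix.diagonal_mulVec_single, mul_one, ← WithLp.toLp_smul, ← Matrix.mulVec_smul,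
      ← Pi.single_smul, smul_eq_mul, mul_one]
  have hu0 : 0 < ‖u‖ := by
    refine norm_pos_iff.2 fun h0 => ?_
    have hmul : U.mulVec (Pi.single j 1) = 0 := congrArg WithLp.ofLp h0
    have : (U.transpose * U).mulVec (Pi.single j 1) = 0 := by
      rw [← Matrix.mulVec_mulVec, hmul, Matrix.mulVec_zero]
    rw [hU, Matrix.one_mulVec] at this
    simpa using congrFun this j
  have hle := (Matrix.toEuclideanCLM (𝕜 := ℝ) A).le_opNorm u
  rw [hAu, norm_smul, Real.norm_eq_abs] at hle
  exact le_of_mul_le_mul_right hle hu0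

/-- An orthogonal matrix preserves the sum of squares. -/
theorem sum_mulVec_sq_of_transpose_mul_self {n : ℕ} {U : Matrix (Fin n) (Fin n) ℝ}
    (hU : U.transpose * U = 1) (w : Fin n → ℝ) :
    ∑ j, U.mulVec w j ^ 2 = ∑ j, w j ^ 2 := by
  have hdot (z : Fin n → ℝ) : ∑ j, z j ^ 2 = z ⬝ᵥ z := by simp [dotProduct, sq]
  rw [hdot, hdot, Matrix.dotProduct_mulVec, ← Matrix.mulVec_transpose, Matrix.mulVec_mulVec, hU,
    Matrix.one_mulVec]

/-- The residual `(1 - A s(A)) y` in the eigenbasis of `A = U Σ Uᵀ`. -/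
theorem sub_mulVec_spectralCalc_mulVec {n : ℕ} {A U : Matrix (Fin n) (Fin n) ℝ}
    {σd : Fin n → ℝ} (hU : U * U.transpose = 1 ∧ U.transpose * U = 1)
    (hA : A = U * Matrix.diagonal σd * U.transpose) (s : ℝ → ℝ) (y : Fin n → ℝ) :
    y - A.mulVec ((spectralCalc s U σd).mulVec y) =
      U.mulVec fun j => (1 - σd j * s (σd j)) * U.transpose.mulVec y j := by
  have hAs : A * spectralCalc s U σd =
      U * Matrix.diagonal (fun j => σd j * s (σd j)) * U.transpose := by
    rw [hA, spectralCalc, ← Matrix.diagonal_mul_diagonal]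
    calc _ = U * Matrix.diagonal σd * (U.transpose * U) *
          Matrix.diagonal (fun j => s (σd j)) * U.transpose := by simp only [Matrix.mul_assoc]
      _ = _ := by rw [hU.2]; simp only [Matrix.mul_assoc, Matrix.one_mul]
  have hy : y = U.mulVec (U.transpose.mulVec y) := by
    rw [Matrix.mulVec_mulVec, hU.1, Matrix.one_mulVec]
  rw [Matrix.mulVec_mulVec, hAs, ← Matrix.mulVec_mulVec, ← Matrix.mulVec_mulVec]
  nth_rewrite 1 [hy]
  rw [← Matrix.mulVec_sub]
  congr 1
  ext j
  simp only [Pi.sub_apply, Matrix.mulVec_diagonal]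
  ring

/-- Discrete residual bound for spectral regularization in an RKHS: if the filter has
qualification at least `1/2`, i.e. `|√t (1 − t s_λ(t))| ≤ C_{1/2} √λ` on `[0, ‖𝖪‖]`, then
`(∑_j (g(x_j) − ĝ_λ(x_j))²)^{1/2} ≤ C_{1/2} √λ ‖g‖_{H_K}`. -/
theorem stmt6
    {H : Type*} [NormedAddCommGroup H] [InnerProductSpace ℝ H] [CompleteSpace H]
    {X : Type*} [Nonempty X]
    (ev : H →ₗ[ℝ] (X → ℝ)) (K : X → X → ℝ) (Kfun : X → H)
    (hKsec : ∀ x : X, ev (Kfun x) = fun x' => K x' x)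
    (hrepro : ∀ (g : H) (x : X), ⟪g, Kfun x⟫ = ev g x)
    (n : ℕ) (x : Fin n → X) (hx : Function.Injective x)
    (U : Matrix (Fin n) (Fin n) ℝ) (hU : U * U.transpose = 1 ∧ U.transpose * U = 1)
    (σd : Fin n → ℝ)
    (hdecomp : gramMatrix K x = U * Matrix.diagonal σd * U.transpose)
    (s : ℝ → ℝ → ℝ) (Chalf : ℝ)
    (hs : ∀ lam > (0 : ℝ),
      ∀ t ∈ Set.Icc (0 : ℝ) ‖Matrix.toEuclideanCLM (𝕜 := ℝ) (gramMatrix K x)‖,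
        |Real.sqrt t * (1 - t * s lam t)| ≤ Chalf * Real.sqrt lam)
    (g : H) (lam : ℝ) (hlam : 0 < lam) :
    Real.sqrt (∑ j : Fin n,
        (ev g (x j) -
          ev (∑ i : Fin n,
            (spectralCalc (s lam) U σd).mulVec (fun j => ev g (x j)) i • Kfun (x i))
            (x j)) ^ 2)
      ≤ Chalf * Real.sqrt lam * ‖g‖ := by
  set y : Fin n → ℝ := fun j => ev g (x j)
  set C := Chalf * Real.sqrt lam with hC
  have hC0 : 0 ≤ C := (abs_nonneg _).trans (hs lam hlam 0 ⟨le_rfl, norm_nonneg _⟩)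
  let φ : Fin n → H := fun j => ∑ i, U i j • Kfun (x i)
  have hgφ (f : H) (j : Fin n) : ⟪f, φ j⟫ = U.transpose.mulVec (fun i => ev f (x i)) j := by
    simp [φ, inner_sum, inner_smul_right, hrepro, Matrix.mulVec, dotProduct]
  have hevφ (j : Fin n) : (fun i => ev (φ j) (x i)) =
      (gramMatrix K x).mulVec fun i => U i j := by
    ext i
    simp [φ, map_sum, hKsec, Matrix.mulVec, dotProduct, gramMatrix, mul_comm]
  have hφφ (j k : Fin n) : ⟪φ j, φ k⟫ = Matrix.diagonal σd k j := by
    have hdiag : U.transpose * (gramMatrix K x * U) = Matrix.diagonal σd := by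
      rw [hdecomp, Matrix.mul_assoc, hU.2, Matrix.mul_one, ← Matrix.mul_assoc, hU.2,
        Matrix.one_mul]
    rw [hgφ, hevφ, ← hdiag]
    rfl
  have hσ (j : Fin n) : σd j = ‖φ j‖ ^ 2 := by
    rw [← real_inner_self_eq_norm_sq, hφφ, Matrix.diagonal_apply_eq]
  have hbessel := sum_inner_sq_div_norm_sq_le (v := φ)
    (fun j k hjk => (hφφ j k).trans (Matrix.diagonal_apply_ne _ hjk.symm)) g
  have hres (j : Fin n) : ev g (x j) - ev (∑ i : Fin n,
      (spectralCalc (s lam) U σd).mulVec y i • Kfun (x i)) (x j) =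
      U.mulVec (fun j => (1 - σd j * s lam (σd j)) * ⟪g, φ j⟫) j := by
    simp only [hgφ]
    rw [← sub_mulVec_spectralCalc_mulVec hU hdecomp, Pi.sub_apply]
    congr 1
    simp only [map_sum, map_smul, Finset.sum_apply, Pi.smul_apply, hKsec, smul_eq_mul]
    exact Finset.sum_congr rfl fun i _ => mul_comm _ _
  simp only [hres]
  refine Real.sqrt_le_iff.2 ⟨by positivity, ?_⟩
  rw [sum_mulVec_sq_of_transpose_mul_self hU.2, mul_pow]
  calc ∑ j, ((1 - σd j * s lam (σd j)) * ⟪g, φ j⟫) ^ 2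
      ≤ ∑ j, C ^ 2 * (⟪g, φ j⟫ ^ 2 / ‖φ j‖ ^ 2) := by
        refine Finset.sum_le_sum fun j _ => ?_
        rcases eq_or_ne (φ j) 0 with h0 | h0
        · simp [h0]
        have hfilter := hs lam hlam (σd j) ⟨by rw [hσ]; positivity,
          (le_abs_self _).trans
            (abs_le_norm_toEuclideanCLM_of_eq_mul_diagonal_mul_transpose hU.2 hdecomp j)⟩
        have hsq := pow_le_pow_left₀ (abs_nonneg _) hfilter 2
        have hsqrt : Real.sqrt (σd j) = ‖φ j‖ := by rw [hσ, Real.sqrt_sq (norm_nonneg _)]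
        rw [sq_abs, hsqrt, ← hC] at hsq
        have hpos : 0 < ‖φ j‖ ^ 2 := by positivity
        rw [← mul_div_assoc, le_div_iff₀ hpos]
        calc _ = (‖φ j‖ * (1 - σd j * s lam (σd j))) ^ 2 * ⟪g, φ j⟫ ^ 2 := by ring
          _ ≤ _ := mul_le_mul_of_nonneg_right hsq (sq_nonneg _)
    _ = C ^ 2 * ∑ j, ⟪g, φ j⟫ ^ 2 / ‖φ j‖ ^ 2 := by rw [Finset.mul_sum]
    _ ≤ C ^ 2 * ‖g‖ ^ 2 := mul_le_mul_of_nonneg_left hbessel (sq_nonneg _)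
end

section
/- Let H_K be a reproducing kernel Hilbert space on X with kernel K, let X_n = {x₁,…,x_n} ⊂ X be pairwise distinct points with Gram matrix 𝖪 := (K(x_i,x_j))_{i,j=1}^n, and for λ > 0 let s_λ : [0,∞) → ℝ satisfy sup_{t∈[0,‖𝖪‖]} |t·s_λ(t)| ≤ D for all λ > 0. For g ∈ H_K define ĝ_λ := Σ_{i=1}^n α_i K(·,x_i) with α := s_λ(𝖪)·(g(x₁),…,g(x_n))ᵀ, where s_λ(𝖪) is obtained by applying s_λ to the eigenvalues in an orthonormal eigendecomposition of 𝖪. Then for every g ∈ H_K and λ > 0: ‖g − ĝ_λ‖_{H_K} ≤ (D + 1) · ‖g‖_{H_K}. -/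
open scoped RealInnerProductSpace

theorem real_inner_sum_smul_sum_smul {ι H : Type*} [Fintype ι] [DecidableEq ι]
    [NormedAddCommGroup H] [InnerProductSpace ℝ H] {e : ι → H} {σ : ι → ℝ}
    (he : ∀ j k, ⟪e j, e k⟫ = if j = k then σ j else 0) (a b : ι → ℝ) :
    ⟪∑ j, a j • e j, ∑ j, b j • e j⟫ = ∑ j, a j * b j * σ j := by
  simp_rw [sum_inner, inner_sum, real_inner_smul_left, real_inner_smul_right, he]
  simp [mul_assoc]

/-- Bessel's inequality for an orthogonal family of vectors of squared norms `σ j`, some of which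
may vanish. -/
theorem sum_real_inner_sq_div_le {ι H : Type*} [Fintype ι] [DecidableEq ι]
    [NormedAddCommGroup H] [InnerProductSpace ℝ H] {e : ι → H} {σ : ι → ℝ}
    (he : ∀ j k, ⟪e j, e k⟫ = if j = k then σ j else 0) (g : H) :
    ∑ j, ⟪g, e j⟫ ^ 2 / σ j ≤ ‖g‖ ^ 2 := by
  have hsq := norm_sub_sq_real g (∑ j, (⟪g, e j⟫ / σ j) • e j)
  rw [← real_inner_self_eq_norm_sq (∑ j, (⟪g, e j⟫ / σ j) • e j),
    real_inner_sum_smul_sum_smul he, inner_sum] at hsq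
  have h1 : ∑ j, ⟪g, (⟪g, e j⟫ / σ j) • e j⟫ = ∑ j, ⟪g, e j⟫ ^ 2 / σ j :=
    Finset.sum_congr rfl fun j _ => by rw [real_inner_smul_right]; ring
  have h2 : ∑ j, ⟪g, e j⟫ / σ j * (⟪g, e j⟫ / σ j) * σ j = ∑ j, ⟪g, e j⟫ ^ 2 / σ j := by
    refine Finset.sum_congr rfl fun j _ => ?_
    by_cases hj : σ j = 0
    · simp [hj]
    · field_simp
  rw [h1, h2] at hsq
  nlinarith [sq_nonneg ‖g - ∑ j, (⟪g, e j⟫ / σ j) • e j‖]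

theorem norm_sum_mul_inner_smul_le {ι H : Type*} [Fintype ι] [DecidableEq ι]
    [NormedAddCommGroup H] [InnerProductSpace ℝ H] {e : ι → H} {σ : ι → ℝ}
    (he : ∀ j k, ⟪e j, e k⟫ = if j = k then σ j else 0) {a : ι → ℝ} {D : ℝ} (hD : 0 ≤ D)
    (ha : ∀ j, |σ j * a j| ≤ D) (g : H) :
    ‖∑ j, (a j * ⟪g, e j⟫) • e j‖ ≤ D * ‖g‖ := by
  refine le_of_sq_le_sq ?_ (by positivity)
  rw [← real_inner_self_eq_norm_sq, real_inner_sum_smul_sum_smul he, mul_pow]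
  refine le_trans ?_ (mul_le_mul_of_nonneg_left (sum_real_inner_sq_div_le he g) (sq_nonneg D))
  rw [Finset.mul_sum]
  refine Finset.sum_le_sum fun j _ => ?_
  have hσ : 0 ≤ σ j := by
    have := real_inner_self_nonneg (x := e j)
    rwa [he, if_pos rfl] at this
  by_cases hj : σ j = 0
  · simp [hj]
  calc a j * ⟪g, e j⟫ * (a j * ⟪g, e j⟫) * σ j
      = (σ j * a j) ^ 2 * (⟪g, e j⟫ ^ 2 / σ j) := by field_simp
    _ ≤ D ^ 2 * (⟪g, e j⟫ ^ 2 / σ j) :=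
        mul_le_mul_of_nonneg_right (sq_le_sq' (abs_le.1 (ha j)).1 (abs_le.1 (ha j)).2)
          (by positivity)

theorem abs_le_norm_toEuclideanCLM_of_eq {n : ℕ} {A U : Matrix (Fin n) (Fin n) ℝ}
    {σ : Fin n → ℝ} (hU : U.transpose * U = 1)
    (hA : A = U * Matrix.diagonal σ * U.transpose) (j : Fin n) :
    |σ j| ≤ ‖Matrix.toEuclideanCLM (𝕜 := ℝ) A‖ := by
  have hAU : A * U = U * Matrix.diagonal σ := by rw [hA, mul_assoc, hU, mul_one]
  set v : EuclideanSpace ℝ (Fin n) := WithLp.toLp 2 fun i => U i j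
  have hv : Matrix.toEuclideanCLM (𝕜 := ℝ) A v = σ j • v := by
    ext i
    have := congrFun (congrFun hAU i) j
    rw [Matrix.mul_diagonal, Matrix.mul_apply] at this
    simp [v, Matrix.toEuclideanCLM_toLp, Matrix.mulVec, dotProduct, this, mul_comm]
  have hv0 : 0 < ‖v‖ := by
    refine norm_pos_iff.2 fun h0 => ?_
    have h1 := congrFun (congrFun hU j) j
    have h2 : ∀ i, U i j = 0 := fun i => congrArg (fun w : EuclideanSpace ℝ (Fin n) => w i) h0
    simp [Matrix.mul_apply, h2] at h1
  have h := (Matrix.toEuclideanCLM (𝕜 := ℝ) A).le_opNorm v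
  rw [hv, norm_smul, Real.norm_eq_abs] at h
  exact le_of_mul_le_mul_right h hv0

/-- Stability of spectral regularization in the RKHS norm: if `|t s_λ(t)| ≤ D` on
`[0, ‖𝖪‖]`, then `‖g − ĝ_λ‖_{H_K} ≤ (D + 1) ‖g‖_{H_K}`. -/
theorem stmt7
    {H : Type*} [NormedAddCommGroup H] [InnerProductSpace ℝ H] [CompleteSpace H]
    {X : Type*} [Nonempty X]
    (ev : H →ₗ[ℝ] (X → ℝ)) (K : X → X → ℝ) (Kfun : X → H)
    (hKsec : ∀ x : X, ev (Kfun x) = fun x' => K x' x)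
    (hrepro : ∀ (g : H) (x : X), ⟪g, Kfun x⟫ = ev g x)
    (n : ℕ) (x : Fin n → X) (hx : Function.Injective x)
    (U : Matrix (Fin n) (Fin n) ℝ) (hU : U * U.transpose = 1 ∧ U.transpose * U = 1)
    (σd : Fin n → ℝ)
    (hdecomp : gramMatrix K x = U * Matrix.diagonal σd * U.transpose)
    (s : ℝ → ℝ → ℝ) (D : ℝ)
    (hs : ∀ lam > (0 : ℝ),
      ∀ t ∈ Set.Icc (0 : ℝ) ‖Matrix.toEuclideanCLM (𝕜 := ℝ) (gramMatrix K x)‖,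
        |t * s lam t| ≤ D)
    (g : H) (lam : ℝ) (hlam : 0 < lam) :
    ‖g - ∑ i : Fin n,
        (spectralCalc (s lam) U σd).mulVec (fun j => ev g (x j)) i • Kfun (x i)‖
      ≤ (D + 1) * ‖g‖ := by
  classical
  set e : Fin n → H := fun j => ∑ i, U i j • Kfun (x i) with he_def
  have hK : ∀ i k, ⟪Kfun (x i), Kfun (x k)⟫ = gramMatrix K x k i := fun i k => by
    rw [hrepro, hKsec]; rfl
  have hdiag : U.transpose * gramMatrix K x * U = Matrix.diagonal σd := by
    rw [hdecomp, mul_assoc, mul_assoc, hU.2, mul_one, ← mul_assoc, hU.2, one_mul]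
  have he : ∀ j k, ⟪e j, e k⟫ = if j = k then σd j else 0 := fun j k => by
    have h := congrFun (congrFun hdiag k) j
    rw [Matrix.diagonal_apply] at h
    simp_rw [he_def, sum_inner, inner_sum, real_inner_smul_left, real_inner_smul_right, hK]
    simp_rw [Matrix.mul_apply, Finset.sum_mul, Matrix.transpose_apply] at h
    have h' : (if j = k then σd j else 0) = if k = j then σd k else 0 := by
      rcases eq_or_ne j k with rfl | hjk
      · rfl
      · rw [if_neg hjk, if_neg hjk.symm]
    rw [h', ← h]
    exact Finset.sum_congr rfl fun i _ => Finset.sum_congr rfl fun l _ => by ring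
  have hinner : ∀ j, ⟪g, e j⟫ = ∑ i, U i j * ev g (x i) := fun j => by
    simp_rw [he_def, inner_sum, real_inner_smul_right, hrepro]
  have hghat : ∑ i, (spectralCalc (s lam) U σd).mulVec (fun j => ev g (x j)) i • Kfun (x i)
      = ∑ j, (s lam (σd j) * ⟪g, e j⟫) • e j := by
    simp_rw [he_def, Finset.smul_sum, smul_smul]
    rw [Finset.sum_comm]
    refine Finset.sum_congr rfl fun i _ => ?_
    rw [← Finset.sum_smul]
    congr 1
    simp_rw [spectralCalc, ← Matrix.mulVec_mulVec]
    rw [Matrix.mulVec, dotProduct]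
    refine Finset.sum_congr rfl fun j _ => ?_
    rw [Matrix.mulVec_diagonal, mul_comm]
    congr 2
    exact (hinner j).symm
  have hD : 0 ≤ D := (abs_nonneg _).trans (hs lam hlam 0 ⟨le_rfl, norm_nonneg _⟩)
  have hσ : ∀ j, 0 ≤ σd j := fun j => by
    have := real_inner_self_nonneg (x := e j)
    rwa [he, if_pos rfl] at this
  have hbound := norm_sum_mul_inner_smul_le he hD (a := fun j => s lam (σd j))
    (fun j => hs lam hlam _
      ⟨hσ j, (le_abs_self _).trans (abs_le_norm_toEuclideanCLM_of_eq hU.2 hdecomp j)⟩) g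
  rw [hghat]
  linarith [norm_sub_le g (∑ j, (s lam (σd j) * ⟪g, e j⟫) • e j)]
end

section
/- Let H_K be a reproducing kernel Hilbert space on X with kernel K, points X_n = {x₁,…,x_n} ⊂ X with Gram matrix 𝖪, and filter functions s_λ satisfying sup_{t∈[0,‖𝖪‖]} |t·s_λ(t)| ≤ D and sup_{t∈[0,‖𝖪‖]} |t^{1/2}(1 − t·s_λ(t))| ≤ C_{1/2}·λ^{1/2} for all λ > 0; for g ∈ H_K let ĝ_λ := Σ_i α_i K(·,x_i) with α := s_λ(𝖪)·(g(x₁),…,g(x_n))ᵀ. Let N be a seminorm on a real vector space containing H_K and A₁, A₂ ≥ 0 constants such that N(z) ≤ A₁·‖z‖_{H_K} + A₂·max_{1≤j≤n} |z(x_j)| for all z ∈ H_K. Then for every g ∈ H_K and λ > 0: N(g − ĝ_λ) ≤ ( (D+1)·A₁ + C_{1/2}·λ^{1/2}·A₂ ) · ‖g‖_{H_K} ≤ max{D+1, C_{1/2}} · (A₁ + A₂·λ^{1/2}) · ‖g‖_{H_K}. In particular, with A₁ = h^{−3|α|} e^{c·log(h)/h} and A₂ = h^{−2|α|} e^{c'/h}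 (the Gaussian-kernel sampling inequality, 0 < h ≤ 1), one obtains N(g − ĝ_λ) ≤ max{D+1, C_{1/2}} · h^{−3|α|} e^{c'/h} · ( e^{−(c' − c·log h)/h} + λ^{1/2} ) · ‖g‖_{H_K}. -/
open scoped RealInnerProductSpace

section OrthogonalFamily

variable {ι H : Type*} [DecidableEq ι] [NormedAddCommGroup H] [InnerProductSpace ℝ H]

theorem nonneg_of_orthogonal {e : ι → H} {σ : ι → ℝ}
    (he : ∀ k l, ⟪e k, e l⟫ = if k = l then σ k else 0) (k : ι) : 0 ≤ σ k := by
  have h := he k k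
  rw [if_pos rfl, real_inner_self_eq_norm_sq] at h
  exact h ▸ sq_nonneg _

variable [Fintype ι]

theorem inner_sum_smul_of_orthogonal {e : ι → H} {σ : ι → ℝ}
    (he : ∀ k l, ⟪e k, e l⟫ = if k = l then σ k else 0) (a : ι → ℝ) (l : ι) :
    ⟪∑ k, a k • e k, e l⟫ = a l * σ l := by
  simp [sum_inner, real_inner_smul_left, he]

theorem norm_sq_sum_smul_of_orthogonal {e : ι → H} {σ : ι → ℝ}
    (he : ∀ k l, ⟪e k, e l⟫ = if k = l then σ k else 0) (a : ι → ℝ) :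
    ‖∑ k, a k • e k‖ ^ 2 = ∑ k, a k ^ 2 * σ k := by
  rw [← real_inner_self_eq_norm_sq, inner_sum]
  refine Finset.sum_congr rfl fun l _ => ?_
  rw [real_inner_smul_right, inner_sum_smul_of_orthogonal he]
  ring

/-- Bessel's inequality for an orthogonal family whose members may vanish: the Fourier
coefficients `⟪g, e k⟫ / ‖e k‖ ^ 2` exist and are controlled by `‖g‖`. -/
theorem exists_coeff_bessel_of_orthogonal {e : ι → H} {σ : ι → ℝ}
    (he : ∀ k l, ⟪e k, e l⟫ = if k = l then σ k else 0) (g : H) :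
    ∃ q : ι → ℝ, (∀ k, ⟪g, e k⟫ = σ k * q k) ∧ ∑ k, q k ^ 2 * σ k ≤ ‖g‖ ^ 2 := by
  have hb : ∀ k, ⟪g, e k⟫ = σ k * (⟪g, e k⟫ / σ k) := fun k => by
    rcases eq_or_ne (σ k) 0 with h0 | h0
    · have h := he k k
      rw [if_pos rfl, h0, inner_self_eq_zero] at h
      simp [h]
    · field_simp
  refine ⟨fun k => ⟪g, e k⟫ / σ k, hb, ?_⟩
  have hn := norm_sq_sum_smul_of_orthogonal he fun k => ⟪g, e k⟫ / σ k
  have hi : ⟪g, ∑ k, (⟪g, e k⟫ / σ k) • e k⟫ = ∑ k, (⟪g, e k⟫ / σ k) ^ 2 * σ k := by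
    rw [inner_sum]
    refine Finset.sum_congr rfl fun k _ => ?_
    rw [real_inner_smul_right]
    conv_lhs => rw [hb k]
    field_simp
  have hcs := real_inner_le_norm g (∑ k, (⟪g, e k⟫ / σ k) • e k)
  rw [hi, ← hn] at hcs
  rw [← hn]
  nlinarith [sq_nonneg (‖g‖ - ‖∑ k, (⟪g, e k⟫ / σ k) • e k‖)]

end OrthogonalFamily

theorem Matrix.abs_le_norm_of_eq_mul_diagonal_mul {n : Type*} [Fintype n] [DecidableEq n]
    {G U : Matrix n n ℝ} {σ : n → ℝ} (hU : U.transpose * U = 1)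
    (hG : G = U * Matrix.diagonal σ * U.transpose) (k : n) :
    |σ k| ≤ ‖Matrix.toEuclideanCLM (𝕜 := ℝ) G‖ := by
  have hGU : G * U = U * Matrix.diagonal σ := by
    rw [hG, Matrix.mul_assoc, hU, Matrix.mul_one]
  set u : EuclideanSpace ℝ n := WithLp.toLp 2 fun i => U i k with hu
  have hGu : Matrix.toEuclideanCLM (𝕜 := ℝ) G u = σ k • u := by
    ext i
    have h := congrFun (congrFun hGU i) k
    rw [Matrix.mul_diagonal, Matrix.mul_apply] at h
    simp [hu, Matrix.mulVec, dotProduct, h, mul_comm]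
  have hnu : ‖u‖ = 1 := by
    have h := congrFun (congrFun hU k) k
    rw [Matrix.mul_apply, Matrix.one_apply_eq] at h
    rw [EuclideanSpace.norm_eq, Real.sqrt_eq_one, ← h]
    exact Finset.sum_congr rfl fun i _ => by simp [hu, sq]
  have h := (Matrix.toEuclideanCLM (𝕜 := ℝ) G).le_opNorm u
  rwa [hGu, norm_smul, hnu, mul_one, mul_one, Real.norm_eq_abs] at h

section SpectralFilter

variable {ι H : Type*} [Fintype ι] [DecidableEq ι] [NormedAddCommGroup H] [InnerProductSpace ℝ H]

theorem norm_filter_le_of_orthogonal {e : ι → H} {σ : ι → ℝ}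
    (he : ∀ k l, ⟪e k, e l⟫ = if k = l then σ k else 0) {s : ι → ℝ} {D : ℝ} (hD : 0 ≤ D)
    (hs : ∀ k, |σ k * s k| ≤ D) (g : H) :
    ‖∑ k, (s k * ⟪g, e k⟫) • e k‖ ≤ D * ‖g‖ := by
  obtain ⟨q, hq, hqg⟩ := exists_coeff_bessel_of_orthogonal he g
  refine le_of_sq_le_sq ?_ (by positivity)
  rw [norm_sq_sum_smul_of_orthogonal he]
  calc ∑ k, (s k * ⟪g, e k⟫) ^ 2 * σ k
      ≤ ∑ k, D ^ 2 * (q k ^ 2 * σ k) := Finset.sum_le_sum fun k _ => by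
        have h : (σ k * s k) ^ 2 ≤ D ^ 2 := sq_le_sq' (abs_le.1 (hs k)).1 (abs_le.1 (hs k)).2
        have h' := mul_le_mul_of_nonneg_right h
          (mul_nonneg (sq_nonneg (q k)) (nonneg_of_orthogonal he k))
        rw [hq k]
        linarith
    _ ≤ (D * ‖g‖) ^ 2 := by
        rw [← Finset.mul_sum, mul_pow]
        gcongr

theorem sum_sq_inner_residual_le_of_orthogonal {e : ι → H} {σ : ι → ℝ}
    (he : ∀ k l, ⟪e k, e l⟫ = if k = l then σ k else 0) {s : ι → ℝ} {C : ℝ}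
    (hs : ∀ k, |√(σ k) * (1 - σ k * s k)| ≤ C) (g : H) :
    ∑ k, ⟪g - ∑ l, (s l * ⟪g, e l⟫) • e l, e k⟫ ^ 2 ≤ (C * ‖g‖) ^ 2 := by
  obtain ⟨q, hq, hqg⟩ := exists_coeff_bessel_of_orthogonal he g
  calc ∑ k, ⟪g - ∑ l, (s l * ⟪g, e l⟫) • e l, e k⟫ ^ 2
      ≤ ∑ k, C ^ 2 * (q k ^ 2 * σ k) := Finset.sum_le_sum fun k _ => by
        have h : (√(σ k) * (1 - σ k * s k)) ^ 2 ≤ C ^ 2 :=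
          sq_le_sq' (abs_le.1 (hs k)).1 (abs_le.1 (hs k)).2
        have hσ := nonneg_of_orthogonal he k
        rw [mul_pow, Real.sq_sqrt hσ] at h
        have h' := mul_le_mul_of_nonneg_right h (mul_nonneg (sq_nonneg (q k)) hσ)
        rw [inner_sub_left, inner_sum_smul_of_orthogonal he, hq k]
        linarith
    _ ≤ (C * ‖g‖) ^ 2 := by
        rw [← Finset.mul_sum, mul_pow]
        gcongr

end SpectralFilter

/-- Sampling-inequality error bound for spectral regularization (infinitely smooth case):
if `N z ≤ A₁ ‖z‖_{H_K} + A₂ max_j |z(x_j)|`, then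
`N(g − ĝ_λ) ≤ ((D+1) A₁ + C_{1/2} √λ A₂) ‖g‖ ≤ max{D+1, C_{1/2}} (A₁ + A₂ √λ) ‖g‖`;
in particular, for the Gaussian-kernel sampling inequality
(`A₁ = h^{−3|α|} e^{c log h / h}`, `A₂ = h^{−2|α|} e^{c'/h}`, `0 < h ≤ 1`), one has
`N(g − ĝ_λ) ≤ max{D+1, C_{1/2}} h^{−3|α|} e^{c'/h} (e^{−(c' − c log h)/h} + √λ) ‖g‖`. -/
theorem stmt9
    {H : Type*} [NormedAddCommGroup H] [InnerProductSpace ℝ H] [CompleteSpace H]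
    {X : Type*} [Nonempty X]
    (ev : H →ₗ[ℝ] (X → ℝ)) (K : X → X → ℝ) (Kfun : X → H)
    (hKsec : ∀ x : X, ev (Kfun x) = fun x' => K x' x)
    (hrepro : ∀ (g : H) (x : X), ⟪g, Kfun x⟫ = ev g x)
    (n : ℕ) (hn : 0 < n) (x : Fin n → X) (hx : Function.Injective x)
    (U : Matrix (Fin n) (Fin n) ℝ) (hU : U * U.transpose = 1 ∧ U.transpose * U = 1)
    (σd : Fin n → ℝ)
    (hdecomp : gramMatrix K x = U * Matrix.diagonal σd * U.transpose)
    (s : ℝ → ℝ → ℝ) (D Chalf : ℝ)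
    (hsD : ∀ lam > (0 : ℝ),
      ∀ t ∈ Set.Icc (0 : ℝ) ‖Matrix.toEuclideanCLM (𝕜 := ℝ) (gramMatrix K x)‖,
        |t * s lam t| ≤ D)
    (hsq : ∀ lam > (0 : ℝ),
      ∀ t ∈ Set.Icc (0 : ℝ) ‖Matrix.toEuclideanCLM (𝕜 := ℝ) (gramMatrix K x)‖,
        |Real.sqrt t * (1 - t * s lam t)| ≤ Chalf * Real.sqrt lam)
    (N : Seminorm ℝ H) (A₁ A₂ : ℝ) (hA₁ : 0 ≤ A₁) (hA₂ : 0 ≤ A₂)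
    (hsamp : ∀ z : H, N z ≤ A₁ * ‖z‖ + A₂ * ⨆ j : Fin n, |ev z (x j)|)
    (g : H) (lam : ℝ) (hlam : 0 < lam) :
    (N (g - ∑ i : Fin n,
        (spectralCalc (s lam) U σd).mulVec (fun j => ev g (x j)) i • Kfun (x i))
      ≤ ((D + 1) * A₁ + Chalf * Real.sqrt lam * A₂) * ‖g‖) ∧
    (((D + 1) * A₁ + Chalf * Real.sqrt lam * A₂) * ‖g‖
      ≤ max (D + 1) Chalf * (A₁ + A₂ * Real.sqrt lam) * ‖g‖) ∧
    (∀ (k : ℕ) (c c' h : ℝ), 0 < h → h ≤ 1 →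
      A₁ = h ^ (-(3 * (k : ℝ))) * Real.exp (c * Real.log h / h) →
      A₂ = h ^ (-(2 * (k : ℝ))) * Real.exp (c' / h) →
      N (g - ∑ i : Fin n,
          (spectralCalc (s lam) U σd).mulVec (fun j => ev g (x j)) i • Kfun (x i))
        ≤ max (D + 1) Chalf * (h ^ (-(3 * (k : ℝ))) * Real.exp (c' / h)) *
            (Real.exp (-(c' - c * Real.log h) / h) + Real.sqrt lam) * ‖g‖) := by
  have hzero : (0 : ℝ) ∈ Set.Icc (0 : ℝ) ‖Matrix.toEuclideanCLM (𝕜 := ℝ) (gramMatrix K x)‖ :=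
    ⟨le_rfl, norm_nonneg _⟩
  have hD : 0 ≤ D := (abs_nonneg _).trans (hsD lam hlam 0 hzero)
  have hsl : 0 < √lam := Real.sqrt_pos.2 hlam
  have hC : 0 ≤ Chalf :=
    nonneg_of_mul_nonneg_left ((abs_nonneg _).trans (hsq lam hlam 0 hzero)) hsl
  set e : Fin n → H := fun k => ∑ i, U i k • Kfun (x i) with he_def
  have hdiag : U.transpose * gramMatrix K x * U = Matrix.diagonal σd := by
    rw [hdecomp, Matrix.mul_assoc, Matrix.mul_assoc, hU.2, Matrix.mul_one, ← Matrix.mul_assoc,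
      hU.2, Matrix.one_mul]
  have he : ∀ k l, ⟪e k, e l⟫ = if k = l then σd k else 0 := fun k l => by
    have h := congrFun (congrFun hdiag l) k
    rw [Matrix.diagonal_apply, Matrix.mul_apply] at h
    simp only [Matrix.mul_apply, Matrix.transpose_apply, gramMatrix, Matrix.of_apply] at h
    have h' : (if k = l then σd k else 0) = if l = k then σd l else 0 := by
      rcases eq_or_ne k l with rfl | hkl
      · rfl
      · rw [if_neg hkl, if_neg hkl.symm]
    rw [h', ← h]
    simp only [he_def, sum_inner, inner_sum, real_inner_smul_right, hrepro, map_smul,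
      Pi.smul_apply, smul_eq_mul, hKsec, Finset.sum_mul]
    rw [Finset.sum_comm]
    exact Finset.sum_congr rfl fun i _ => Finset.sum_congr rfl fun j _ => by ring
  have hb : ∀ k, ⟪g, e k⟫ = ∑ j, U j k * ev g (x j) := fun k => by
    simp only [he_def, inner_sum, real_inner_smul_right, hrepro]
  have hspec : ∑ i : Fin n,
      (spectralCalc (s lam) U σd).mulVec (fun j => ev g (x j)) i • Kfun (x i)
        = ∑ k, (s lam (σd k) * ⟪g, e k⟫) • e k := by
    have hcoef : ∀ i, (spectralCalc (s lam) U σd).mulVec (fun j => ev g (x j)) i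
        = ∑ k, (s lam (σd k) * ⟪g, e k⟫) * U i k := fun i => by
      rw [spectralCalc, ← Matrix.mulVec_mulVec, Matrix.mulVec, dotProduct]
      refine Finset.sum_congr rfl fun k _ => ?_
      rw [Matrix.mul_diagonal, hb k, Matrix.mulVec, dotProduct]
      simp only [Matrix.transpose_apply]
      ring
    simp only [hcoef, Finset.sum_smul, he_def, Finset.smul_sum, smul_smul]
    exact Finset.sum_comm
  have hmem : ∀ k, σd k ∈
      Set.Icc (0 : ℝ) ‖Matrix.toEuclideanCLM (𝕜 := ℝ) (gramMatrix K x)‖ := fun k =>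
    ⟨nonneg_of_orthogonal he k,
      (le_abs_self _).trans (Matrix.abs_le_norm_of_eq_mul_diagonal_mul hU.2 hdecomp k)⟩
  rw [hspec]
  set f : H := g - ∑ k, (s lam (σd k) * ⟪g, e k⟫) • e k with hf
  have hnorm : ‖f‖ ≤ (D + 1) * ‖g‖ := by
    have h := norm_filter_le_of_orthogonal he hD (fun k => hsD lam hlam _ (hmem k)) g
    have h' := norm_sub_le g (∑ k, (s lam (σd k) * ⟪g, e k⟫) • e k)
    linarith
  have hpoint : ∀ j, |ev f (x j)| ≤ Chalf * √lam * ‖g‖ := fun j => by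
    have hres := sum_sq_inner_residual_le_of_orthogonal he
      (fun k => hsq lam hlam _ (hmem k)) g
    have hrow : ∑ k, U j k ^ 2 = 1 := by
      have h := congrFun (congrFun hU.1 j) j
      rw [Matrix.mul_apply, Matrix.one_apply_eq] at h
      rw [← h]
      exact Finset.sum_congr rfl fun k _ => by rw [Matrix.transpose_apply, sq]
    have hev : ev f (x j) = ∑ k, U j k * ⟪f, e k⟫ := by
      simp only [he_def, inner_sum, real_inner_smul_right, hrepro, Finset.mul_sum]
      rw [Finset.sum_comm]
      have h : ∀ i, ∑ k, U j k * (U i k * ev f (x i))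
          = (U * U.transpose) j i * ev f (x i) := fun i => by
        rw [Matrix.mul_apply, Finset.sum_mul]
        exact Finset.sum_congr rfl fun k _ => by rw [Matrix.transpose_apply]; ring
      simp [h, hU.1, Matrix.one_apply]
    refine abs_le_of_sq_le_sq ?_ (by positivity)
    rw [hev]
    refine (Finset.sum_mul_sq_le_sq_mul_sq _ _ _).trans ?_
    rwa [hrow, one_mul]
  have hmain : N f ≤ ((D + 1) * A₁ + Chalf * √lam * A₂) * ‖g‖ := by
    have : Nonempty (Fin n) := ⟨⟨0, hn⟩⟩
    have h₁ := mul_le_mul_of_nonneg_left hnorm hA₁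
    have h₂ := mul_le_mul_of_nonneg_left (ciSup_le hpoint) hA₂
    have := hsamp f
    linarith
  have hmax : ((D + 1) * A₁ + Chalf * √lam * A₂) * ‖g‖
      ≤ max (D + 1) Chalf * (A₁ + A₂ * √lam) * ‖g‖ := by
    have h₁ := mul_le_mul_of_nonneg_right (le_max_left (D + 1) Chalf) hA₁
    have h₂ := mul_le_mul_of_nonneg_right (le_max_right (D + 1) Chalf)
      (mul_nonneg hA₂ hsl.le)
    refine mul_le_mul_of_nonneg_right ?_ (norm_nonneg g)
    linarith
  refine ⟨hmain, hmax, fun k c c' h h0 h1 e₁ e₂ => (hmain.trans hmax).trans ?_⟩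
  have hM : 0 ≤ max (D + 1) Chalf := hC.trans (le_max_right _ _)
  have hpow : h ^ (-(2 * (k : ℝ))) ≤ h ^ (-(3 * (k : ℝ))) :=
    Real.rpow_le_rpow_of_exponent_ge h0 h1 (by linarith [(Nat.cast_nonneg k : (0 : ℝ) ≤ k)])
  have hexp : Real.exp (c * Real.log h / h)
      = Real.exp (c' / h) * Real.exp (-(c' - c * Real.log h) / h) := by
    rw [← Real.exp_add]
    ring_nf
  have hA : A₁ + A₂ * √lam ≤ h ^ (-(3 * (k : ℝ))) * Real.exp (c' / h) *
      (Real.exp (-(c' - c * Real.log h) / h) + √lam) := by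
    rw [e₁, e₂, hexp, mul_add, ← mul_assoc]
    gcongr
  rw [mul_assoc (max (D + 1) Chalf) (_ * _) _]
  gcongr
end

section
/- Let τ > 0, d > 0 and C₁, C₂ > 0. For n ∈ ℕ, n ≥ 1, set h_n := n^{−1/d} and define the error bound functions B(n, λ) := C₁ · h_n^{d/2} · ( h_n^{τ − d/2} + λ^{1/2} ) + C₂ / (√n · λ) and B'(n, λ) := C₁ · h_n^{d/2} · ( h_n^{τ − d/2} + λ^{1/2} ) + C₂ / (n · λ). Then: (i) there exist constants λ₀ > 0 and C > 0 such that B(n, λ₀) ≤ C · n^{−min(τ/d, 1/2)} for all n ≥ 1; (ii) there exists C > 0 such that, taking λ_n := n^{−1/3}, B'(n, λ_n) ≤ C · n^{−min(τ/d, 2/3)} for all n ≥ 1. -/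
/-- A combination of two powers of `x ≥ 1` decays at the slower of the two rates. -/
theorem rpow_combination_le {x a b p q : ℝ} (hx : 1 ≤ x) (hp : 0 ≤ p) (hq : 0 ≤ q) :
    p * x ^ (-a) + q * x ^ (-b) ≤ (p + q) * x ^ (-(min a b)) := by
  have ha : x ^ (-a) ≤ x ^ (-(min a b)) :=
    Real.rpow_le_rpow_of_exponent_le hx (neg_le_neg (min_le_left a b))
  have hb : x ^ (-b) ≤ x ^ (-(min a b)) :=
    Real.rpow_le_rpow_of_exponent_le hx (neg_le_neg (min_le_right a b))
  rw [add_mul]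
  gcongr

/-- The half-dimensional power of the fill distance `x ^ (-1 / d)`. -/
theorem fillDistance_rpow_half {x d : ℝ} (hx : 0 < x) (hd : 0 < d) :
    (x ^ (-1 / d)) ^ (d / 2) = x ^ (-(1 / 2 : ℝ)) := by
  rw [← Real.rpow_mul hx.le]
  congr 1
  field_simp

/-- The two powers of the fill distance `x ^ (-1 / d)` in the bias combine to `x ^ (-(τ / d))`. -/
theorem fillDistance_rpow_mul {x : ℝ} (τ : ℝ) {d : ℝ} (hx : 0 < x) :
    (x ^ (-1 / d)) ^ (d / 2) * (x ^ (-1 / d)) ^ (τ - d / 2) = x ^ (-(τ / d)) := by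
  rw [← Real.rpow_add (Real.rpow_pos_of_pos hx _), ← Real.rpow_mul hx.le]
  congr 1
  ring


/-- Optimal weak convergence rates for test functions in `D((A*)†)`: with fill distance
`h_n = n^{−1/d}`, the bound `B(n,λ) = C₁ h_n^{d/2}(h_n^{τ−d/2} + λ^{1/2}) + C₂/(√n λ)`
admits a constant choice `lam₀` with `B(n,lam₀) ≤ C n^{−min(τ/d, 1/2)}`, and the trace-class
bound `B'(n,λ) = C₁ h_n^{d/2}(h_n^{τ−d/2} + λ^{1/2}) + C₂/(n λ)` satisfies
`B'(n, n^{−1/3}) ≤ C n^{−min(τ/d, 2/3)}`. -/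
theorem stmt15 (τ d C₁ C₂ : ℝ) (hτ : 0 < τ) (hd : 0 < d) (hC₁ : 0 < C₁) (hC₂ : 0 < C₂) :
    (∃ lam₀ > (0 : ℝ), ∃ C > (0 : ℝ), ∀ n : ℕ, 1 ≤ n →
      C₁ * ((n : ℝ) ^ (-1 / d)) ^ (d / 2) *
          (((n : ℝ) ^ (-1 / d)) ^ (τ - d / 2) + lam₀ ^ ((1 : ℝ) / 2))
        + C₂ / (Real.sqrt n * lam₀)
        ≤ C * (n : ℝ) ^ (-(min (τ / d) (1 / 2)))) ∧
    (∃ C > (0 : ℝ), ∀ n : ℕ, 1 ≤ n →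
      C₁ * ((n : ℝ) ^ (-1 / d)) ^ (d / 2) *
          (((n : ℝ) ^ (-1 / d)) ^ (τ - d / 2) +
            ((n : ℝ) ^ (-(1 : ℝ) / 3)) ^ ((1 : ℝ) / 2))
        + C₂ / ((n : ℝ) * (n : ℝ) ^ (-(1 : ℝ) / 3))
        ≤ C * (n : ℝ) ^ (-(min (τ / d) (2 / 3)))) := by
  refine ⟨⟨1, one_pos, C₁ + (C₁ + C₂), by positivity, fun n hn => ?_⟩,
    ⟨C₁ + (C₁ + C₂), by positivity, fun n hn => ?_⟩⟩
  · have hx : (1 : ℝ) ≤ n := by exact_mod_cast hn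
    have hx0 : (0 : ℝ) < n := by linarith
    have hv : C₂ / (Real.sqrt n * 1) = C₂ * (n : ℝ) ^ (-(1 / 2 : ℝ)) := by
      rw [mul_one, Real.sqrt_eq_rpow, Real.rpow_neg hx0.le, div_eq_mul_inv]
    rw [mul_add, mul_assoc, fillDistance_rpow_mul τ hx0, fillDistance_rpow_half hx0 hd, hv,
      Real.one_rpow, mul_one, add_assoc, ← add_mul]
    exact rpow_combination_le hx hC₁.le (by positivity)
  · have hx : (1 : ℝ) ≤ n := by exact_mod_cast hn
    have hx0 : (0 : ℝ) < n := by linarith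
    have hv : C₂ / ((n : ℝ) * (n : ℝ) ^ (-(1 : ℝ) / 3)) = C₂ * (n : ℝ) ^ (-(2 / 3 : ℝ)) := by
      rw [← Real.rpow_one_add' hx0.le (by norm_num), Real.rpow_neg hx0.le, div_eq_mul_inv]
      norm_num
    have hb : (n : ℝ) ^ (-(1 / 2 : ℝ)) * ((n : ℝ) ^ (-(1 : ℝ) / 3)) ^ ((1 : ℝ) / 2) =
        (n : ℝ) ^ (-(2 / 3 : ℝ)) := by
      rw [← Real.rpow_mul hx0.le, ← Real.rpow_add hx0]
      norm_num
    rw [mul_add, mul_assoc, fillDistance_rpow_mul τ hx0, fillDistance_rpow_half hx0 hd, hv,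
      mul_assoc, hb, add_assoc, ← add_mul]
    exact rpow_combination_le hx hC₁.le (by positivity)
end
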